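/- (Hoffman's duality for S⋆.) Let k be a nonempty index and k∨ its Hoffman dual. Then for every integer N≥0, S⋆(k,N) = Σ_{n=1}^{N} (−1)^{n−1} s⋆(k∨,n) · binom(N, n). -/

import Mathlib

open MeasureTheory Filter Topology

namespace Kawashima

/-- The set `A(k) = {k₁, k₁+k₂, …, k₁+⋯+k_{r-1}}` of proper nonempty partial sums
of an index `k = (k₁, …, k_r)`. -/
def Aset (k : List ℕ) : Finset ℕ :=
  (Finset.Ico 1 k.length).image (fun i => (k.take i).sum)

/-- The Hoffman dual of an index `k`: the unique index `k∨` with the same weight such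
that `A(k)` and `A(k∨)` partition `{1, …, wt(k) - 1}`.  It is computed here as the
composition of `wt(k)` whose partial-sum set is the complement of `A(k)`. -/
def hdual (k : List ℕ) : List ℕ :=
  let w := k.sum
  let L := (insert w ((Finset.Icc 1 (w - 1)) \ Aset k)).sort (· ≤ ·)
  L.zipWith (fun a b => a - b) (0 :: L)

/-- `sStar k N = s⋆(k, N) = Σ_{0 < m₁ ≤ ⋯ ≤ m_{r-1} ≤ m_r = N} 1/(m₁^{k₁} ⋯ m_r^{k_r})`.
For the empty index the value is `1` (empty product), and for a nonempty index and
`N = 0` the value is `0` (empty sum). -/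
noncomputable def sStar (k : List ℕ) (N : ℕ) : ℝ :=
  ∑ m : Fin k.length → Fin (N + 1),
    if (∀ i, 0 < (m i : ℕ)) ∧
       (∀ i j : Fin k.length, i ≤ j → (m i : ℕ) ≤ (m j : ℕ)) ∧
       (∀ i : Fin k.length, (i : ℕ) + 1 = k.length → (m i : ℕ) = N)
    then ∏ i : Fin k.length, 1 / ((m i : ℕ) : ℝ) ^ k.get i
    else 0

/-- `SStar k N = S⋆(k, N) = Σ_{n=1}^N s⋆(k, n)`. -/
noncomputable def SStar (k : List ℕ) (N : ℕ) : ℝ :=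
  ∑ n ∈ Finset.Icc 1 N, sStar k n

/-- The binomial coefficient `binom(z, n) = z(z-1)⋯(z-n+1)/n!` for complex `z`. -/
noncomputable def cbinom (z : ℂ) (n : ℕ) : ℂ :=
  (descPochhammer ℂ n).eval z / (n.factorial : ℂ)

/-- The Kawashima function
`F_k(z) = Σ_{n=1}^∞ (-1)^{n-1} s⋆(k∨, n) binom(z, n)`, with `F_∅(z) = 1`. -/
noncomputable def F (k : List ℕ) (z : ℂ) : ℂ :=
  if k = [] then 1
  else ∑' n : ℕ, (-1 : ℂ) ^ n * ((sStar (hdual k) (n + 1) : ℝ) : ℂ) * cbinom z (n + 1)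

/-- The domain `Δ(k) ⊆ (0,1)^{wt(k)}`: `t_j < t_{j+1}` if `j ∈ A(k)` and
`t_j > t_{j+1}` otherwise (positions `1`-indexed). -/
def Delta (k : List ℕ) : Set (Fin k.sum → ℝ) :=
  {t | (∀ j, t j ∈ Set.Ioo (0 : ℝ) 1) ∧
       ∀ (i : Fin k.sum) (h : (i : ℕ) + 1 < k.sum),
         if (i : ℕ) + 1 ∈ Aset k then t i < t ⟨(i : ℕ) + 1, h⟩
         else t ⟨(i : ℕ) + 1, h⟩ < t i}

/-- The multiple zeta value `ζ(k) = Σ_{0 < m₁ < ⋯ < m_r} 1/(m₁^{k₁} ⋯ m_r^{k_r})`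
(as a `tsum`; it converges for admissible `k`), with `ζ(∅) = 1`. -/
noncomputable def mzv (k : List ℕ) : ℝ :=
  ∑' m : Fin k.length → ℕ,
    if (∀ i, 0 < m i) ∧ (∀ i j : Fin k.length, i < j → m i < m j)
    then ∏ i : Fin k.length, 1 / ((m i : ℕ) : ℝ) ^ k.get i
    else 0

/-- `ζ` extended `ℚ`-linearly to formal `ℚ`-linear combinations of indices. -/
noncomputable def zetaL (v : List ℕ →₀ ℚ) : ℝ :=
  v.sum fun k a => (a : ℝ) * mzv k

/-- The Kawashima function extended `ℚ`-linearly to formal combinations of indices. -/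
noncomputable def FL (v : List ℕ →₀ ℚ) (z : ℂ) : ℂ :=
  v.sum fun k a => (a : ℂ) * F k z

/-- Auxiliary harmonic product, on *reversed* indices (so that the rightmost entry of
the index is the head of the list):
`k * l = (k₋ * l, k_r) + (k * l₋, l_s) + (k₋ * l₋, k_r + l_s)`. -/
noncomputable def hstarAux : List ℕ → List ℕ → (List ℕ →₀ ℚ)
  | [], l => Finsupp.single l 1
  | a :: k, [] => Finsupp.single (a :: k) 1
  | a :: k, b :: l =>
      Finsupp.mapDomain (List.cons a) (hstarAux k (b :: l)) +
      Finsupp.mapDomain (List.cons b) (hstarAux (a :: k) l) +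
      Finsupp.mapDomain (List.cons (a + b)) (hstarAux k l)
  termination_by k l => k.length + l.length

/-- The harmonic product `k * l` of two indices, as a `ℚ`-linear combination of
indices. -/
noncomputable def hstar (k l : List ℕ) : List ℕ →₀ ℚ :=
  Finsupp.mapDomain List.reverse (hstarAux k.reverse l.reverse)

/-- Auxiliary product `*̄` on reversed indices:
`k *̄ l = (k₋ *̄ l, k_r) + (k *̄ l₋, l_s) - (k₋ *̄ l₋, k_r + l_s)`. -/
noncomputable def hbarAux : List ℕ → List ℕ → (List ℕ →₀ ℚ)
  | [], l => Finsupp.single l 1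
  | a :: k, [] => Finsupp.single (a :: k) 1
  | a :: k, b :: l =>
      Finsupp.mapDomain (List.cons a) (hbarAux k (b :: l)) +
      Finsupp.mapDomain (List.cons b) (hbarAux (a :: k) l) -
      Finsupp.mapDomain (List.cons (a + b)) (hbarAux k l)
  termination_by k l => k.length + l.length

/-- The harmonic product `k *̄ l` of two indices. -/
noncomputable def hbar (k l : List ℕ) : List ℕ →₀ ℚ :=
  Finsupp.mapDomain List.reverse (hbarAux k.reverse l.reverse)

/-- The product `k ⊛ l = (k₋ * l₋, k_r + l_s)` for nonempty indices `k`, `l`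
(and `0` if either is empty). -/
noncomputable def circAst (k l : List ℕ) : List ℕ →₀ ℚ :=
  match k.reverse, l.reverse with
  | a :: k', b :: l' =>
      Finsupp.mapDomain List.reverse
        (Finsupp.mapDomain (List.cons (a + b)) (hstarAux k' l'))
  | _, _ => 0

/-- `⊛` extended bilinearly to formal combinations. -/
noncomputable def circAstL (v w : List ℕ →₀ ℚ) : List ℕ →₀ ℚ :=
  v.sum fun k a => w.sum fun l b => (a * b) • circAst k l

/-- The star operator `k ↦ k⋆`: the sum over all ways to replace commas by pluses
in groups of consecutive entries,
`(k₁,…,k_r)⋆ = Σ_{0<j₁<⋯<j_q=r} (k₁+⋯+k_{j₁}, …, k_{j_{q-1}+1}+⋯+k_{j_q})`. -/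
noncomputable def starOp : List ℕ → (List ℕ →₀ ℚ)
  | [] => Finsupp.single [] 1
  | [a] => Finsupp.single [a] 1
  | a :: b :: k =>
      Finsupp.mapDomain (List.cons a) (starOp (b :: k)) + starOp ((a + b) :: k)
  termination_by k => k.length

/-- The star operator extended `ℚ`-linearly. -/
noncomputable def starL (v : List ℕ →₀ ℚ) : List ℕ →₀ ℚ :=
  v.sum fun k a => a • starOp k

open Classical in
/-- Kawashima's function `G_k(z)`: the sum over tuples `0 < n₁, …, n_w` with
`n_j < n_{j+1}` if `j ∉ A(k)` and `n_j ≤ n_{j+1}` if `j ∈ A(k)`, of the product of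
the factors `1/(n_j + z)` at positions `j ∈ A(k)`, the factor
`1/n_w - 1/(n_w + z)` at the last position, and `1/n_j` elsewhere. -/
noncomputable def G (k : List ℕ) (z : ℂ) : ℂ :=
  ∑' n : Fin k.sum → ℕ,
    if (∀ j, 0 < n j) ∧
       (∀ (i : Fin k.sum) (h : (i : ℕ) + 1 < k.sum),
          if (i : ℕ) + 1 ∈ Aset k then n i ≤ n ⟨(i : ℕ) + 1, h⟩
          else n i < n ⟨(i : ℕ) + 1, h⟩)
    then ∏ j : Fin k.sum,
      if (j : ℕ) + 1 = k.sum then 1 / ((n j : ℕ) : ℂ) - 1 / (((n j : ℕ) : ℂ) + z)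
      else if (j : ℕ) + 1 ∈ Aset k then 1 / (((n j : ℕ) : ℂ) + z)
      else 1 / ((n j : ℕ) : ℂ)
    else 0

open Classical in
/-- `ζ_k(l) = Σ 1/(n₁^{l₁} ⋯ n_w^{l_w})`, summed over the same set of tuples as in
the definition of `G_k`. -/
noncomputable def zetaIdx (k : List ℕ) (l : List ℕ) : ℝ :=
  ∑' n : Fin k.sum → ℕ,
    if (∀ j, 0 < n j) ∧
       (∀ (i : Fin k.sum) (h : (i : ℕ) + 1 < k.sum),
          if (i : ℕ) + 1 ∈ Aset k then n i ≤ n ⟨(i : ℕ) + 1, h⟩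
          else n i < n ⟨(i : ℕ) + 1, h⟩)
    then ∏ j : Fin k.sum, 1 / ((n j : ℕ) : ℝ) ^ (l.getD (j : ℕ) 0)
    else 0

/-- `C_m(k) = Σ_{l₁,…,l_{r-1} ≥ 0, l_r ≥ 1, l₁+⋯+l_r = m}
ζ_k(1,…,1 (k₁-1 ones), l₁+1, …, 1,…,1 (k_r-1 ones), l_r+1)`. -/
noncomputable def Cm (k : List ℕ) (m : ℕ) : ℝ :=
  ∑ l : Fin k.length → Fin (m + 1),
    if (∑ i, (l i : ℕ)) = m ∧
       (∀ i : Fin k.length, (i : ℕ) + 1 = k.length → 1 ≤ (l i : ℕ))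
    then zetaIdx k
      ((List.ofFn (fun i : Fin k.length =>
          List.replicate (k.get i - 1) 1 ++ [(l i : ℕ) + 1])).flatten)
    else 0

/-- The iterated integral `A_m(k)` over `Δ((k,1,…,1))` (`m` trailing ones) of
`ω_{δ(1)}(t₁) ⋯ ω_{δ(w-1)}(t_{w-1}) · dt_w/(1-t_w) · dt_{w+1}/t_{w+1} ⋯ dt_{w+m}/t_{w+m}`. -/
noncomputable def Aint (k : List ℕ) (m : ℕ) : ℝ :=
  ∫ t in Delta (k ++ List.replicate m 1),
    ∏ i : Fin (k ++ List.replicate m 1).sum,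
      if (i : ℕ) + 1 < k.sum then
        (if (i : ℕ) + 1 ∈ Aset k then 1 / (1 - t i) else 1 / t i)
      else if (i : ℕ) + 1 = k.sum then 1 / (1 - t i)
      else 1 / t i

/-- The digamma function `ψ(z) = Γ'(z)/Γ(z)`. -/
noncomputable def digamma (z : ℂ) : ℂ := deriv Complex.Gamma z / Complex.Gamma z

section Nested

open Finset

/-- The summand of `sStar` at the tuple `m`, with the tuple taking values in `ℕ`. -/
noncomputable def starTerm (k : List ℕ) (N : ℕ) {r : ℕ} (m : Fin (r + 1) → ℕ) : ℝ :=
  if (∀ i, 0 < m i) ∧ Monotone m ∧ m (Fin.last r) = N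
  then ∏ i, 1 / (m i : ℝ) ^ k.getD i 0 else 0

lemma sStar_eq_sum_starTerm {k : List ℕ} {r N B : ℕ} (hr : k.length = r + 1) (hB : N < B) :
    sStar k N = ∑ m ∈ Fintype.piFinset (fun _ : Fin (r + 1) => range B), starTerm k N m := by
  have key : ∀ (n : ℕ) (f : Fin n → ℕ), n = r + 1 → (∀ i, f i = k.getD i 0) →
      (∑ m : Fin n → Fin (N + 1),
        if (∀ i, 0 < (m i : ℕ)) ∧ (∀ i j : Fin n, i ≤ j → (m i : ℕ) ≤ (m j : ℕ)) ∧
          (∀ i : Fin n, (i : ℕ) + 1 = n → (m i : ℕ) = N)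
        then ∏ i : Fin n, 1 / ((m i : ℕ) : ℝ) ^ f i else 0) =
      ∑ m ∈ Fintype.piFinset (fun _ : Fin (r + 1) => range B), starTerm k N m := by
    rintro _ f rfl hf
    refine sum_of_injOn (fun m i => (m i : ℕ)) ?_ ?_ ?_ ?_
    · intro m _ m' _ h
      funext i
      exact Fin.ext (congrFun h i)
    · intro m _
      simp only [mem_coe, Fintype.mem_piFinset, mem_range]
      intro i
      have := (m i).isLt
      omega
    · intro m _ hm
      refine if_neg fun ⟨_, hmono, hlast⟩ => hm ?_
      refine ⟨fun i => ⟨m i, ?_⟩, by simp, rfl⟩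
      have := hmono (Fin.le_last i)
      omega
    · intro m _
      have hl : (∀ i : Fin (r + 1), (i : ℕ) + 1 = r + 1 → (m i : ℕ) = N) ↔
          (m (Fin.last r) : ℕ) = N := by
        refine ⟨fun h => h _ rfl, fun h i hi => ?_⟩
        obtain rfl : i = Fin.last r := Fin.ext (by simpa using hi)
        exact h
      simp only [starTerm, hl, hf, Monotone]
  exact key k.length k.get hr (by simp)

lemma sStar_singleton (a : ℕ) {N : ℕ} (hN : 0 < N) : sStar [a] N = 1 / (N : ℝ) ^ a := by
  rw [sStar_eq_sum_starTerm (r := 0) rfl (Nat.lt_succ_self N),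
    sum_eq_single_of_mem (fun _ => N) (by simp)]
  · simp [starTerm, hN, monotone_const]
  · intro m _ hm
    refine if_neg fun ⟨_, _, h⟩ => hm ?_
    funext i
    rw [← h, Fin.fin_one_eq_zero i]
    rfl

lemma monotone_snoc {r N : ℕ} {m : Fin (r + 1) → ℕ} :
    Monotone (Fin.snoc m N : Fin (r + 2) → ℕ) ↔ Monotone m ∧ m (Fin.last r) ≤ N := by
  constructor
  · intro h
    refine ⟨fun i j hij => ?_, ?_⟩
    · simpa using h (Fin.castSucc_le_castSucc_iff.2 hij)
    · simpa using h (Fin.le_last (Fin.last r).castSucc)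
  · rintro ⟨h, hl⟩ i j hij
    induction j using Fin.lastCases with
    | last =>
      induction i using Fin.lastCases with
      | last => rfl
      | cast i => simpa using (h (Fin.le_last i)).trans hl
    | cast j =>
      induction i using Fin.lastCases with
      | last => exact absurd hij (Fin.castSucc_lt_last j).not_ge
      | cast i => simpa using h (Fin.castSucc_le_castSucc_iff.1 hij)

lemma starTerm_concat {k : List ℕ} {r : ℕ} (hr : k.length = r + 1) (a : ℕ) {N : ℕ} (hN : 0 < N)
    (m : Fin (r + 1) → ℕ) :
    starTerm (k ++ [a]) N (Fin.snoc m N : Fin (r + 2) → ℕ) =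
      1 / (N : ℝ) ^ a * ∑ M ∈ Icc 1 N, starTerm k M m := by
  have hsum : ∑ M ∈ Icc 1 N, starTerm k M m =
      if (∀ i, 0 < m i) ∧ Monotone m ∧ m (Fin.last r) ≤ N
      then ∏ i, 1 / (m i : ℝ) ^ k.getD i 0 else 0 := by
    split_ifs with h
    · rw [sum_eq_single_of_mem (m (Fin.last r)) (mem_Icc.2 ⟨h.1 _, h.2.2⟩)]
      · exact if_pos ⟨h.1, h.2.1, rfl⟩
      · exact fun M _ hM => if_neg fun h' => hM h'.2.2.symm
    · refine sum_eq_zero fun M hM => if_neg fun h' => h ⟨h'.1, h'.2.1, ?_⟩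
      rw [h'.2.2]
      exact (mem_Icc.1 hM).2
  have hprod : ∏ i : Fin (r + 2),
      1 / (((Fin.snoc m N : Fin (r + 2) → ℕ) i : ℕ) : ℝ) ^ (k ++ [a]).getD i 0 =
        1 / (N : ℝ) ^ a * ∏ i, 1 / (m i : ℝ) ^ k.getD i 0 := by
    rw [Fin.prod_univ_castSucc, mul_comm]
    congr 1
    · simp [← hr]
    · refine prod_congr rfl fun i _ => ?_
      rw [List.getD_append _ _ _ _ (by simp [hr, i.is_le])]
      simp
  rw [hsum, starTerm, hprod, mul_ite, mul_zero]
  refine if_congr ?_ rfl rfl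
  simp [Fin.forall_fin_succ', monotone_snoc, hN]

lemma sStar_concat {k : List ℕ} (hk : k ≠ []) (a : ℕ) {N : ℕ} (hN : 0 < N) :
    sStar (k ++ [a]) N = 1 / (N : ℝ) ^ a * SStar k N := by
  obtain ⟨r, hr⟩ := Nat.exists_eq_succ_of_ne_zero (mt List.length_eq_zero_iff.1 hk)
  have hS : SStar k N = ∑ m ∈ Fintype.piFinset (fun _ : Fin (r + 1) => range (N + 1)),
      ∑ M ∈ Icc 1 N, starTerm k M m := by
    rw [sum_comm]
    refine sum_congr rfl fun M hM => sStar_eq_sum_starTerm hr ?_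
    have := (mem_Icc.1 hM).2
    omega
  rw [sStar_eq_sum_starTerm (r := r + 1) (by simp [hr]) (Nat.lt_succ_self N), hS, mul_sum]
  symm
  refine sum_of_injOn (fun m => (Fin.snoc m N : Fin (r + 2) → ℕ)) ?_ ?_ ?_ ?_
  · intro m _ m' _ h
    exact (Fin.snoc_inj.1 h).1
  · intro m hm
    have hm : ∀ i, m i < N + 1 := by simpa using hm
    simp only [mem_coe, Fintype.mem_piFinset, mem_range, Fin.forall_fin_succ', Fin.snoc_castSucc,
      Fin.snoc_last]
    exact ⟨⟨fun i => hm _, hm _⟩, Nat.lt_succ_self N⟩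
  · intro m hm hm'
    refine if_neg fun h => hm' ⟨Fin.init m, ?_, ?_⟩
    · simp only [Fintype.mem_piFinset, mem_range] at hm
      simp [Fin.init, hm]
    · simp only [← h.2.2, Fin.snoc_init_self]
  · intro m _
    exact (starTerm_concat hr a hN m).symm

lemma natCast_mul_sStar_concat_succ (k : List ℕ) (a : ℕ) {N : ℕ} (hN : 0 < N) :
    N * sStar (k ++ [a + 1]) N = sStar (k ++ [a]) N := by
  have hN' : (N : ℝ) ≠ 0 := by positivity
  rcases eq_or_ne k [] with rfl | hk
  · simp only [List.nil_append, sStar_singleton _ hN]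
    field_simp
    ring
  · simp only [sStar_concat hk _ hN]
    field_simp
    ring

lemma natCast_mul_sStar_concat_one {k : List ℕ} (hk : k ≠ []) {N : ℕ} (hN : 0 < N) :
    N * sStar (k ++ [1]) N = SStar k N := by
  have hN' : (N : ℝ) ≠ 0 := by positivity
  rw [sStar_concat hk _ hN]
  field_simp

end Nested

section Dual

open Finset

/-- Appending an entry to a list appends one difference to its list of consecutive differences. -/
lemma zipWith_sub_concat (L : List ℕ) (c x : ℕ) :
    List.zipWith (fun a b => a - b) (L ++ [x]) (c :: (L ++ [x])) =
      List.zipWith (fun a b => a - b) L (c :: L) ++ [x - L.getLastD c] := by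
  induction L generalizing c with
  | nil => simp
  | cons y L ih => simp only [List.cons_append, List.zipWith_cons_cons, ih, List.getLastD_cons]

lemma sort_insert_of_forall_lt {s : Finset ℕ} {w : ℕ} (h : ∀ x ∈ s, x < w) :
    (insert w s).sort (· ≤ ·) = s.sort (· ≤ ·) ++ [w] := by
  have hw : w ∉ s := fun hw => (h w hw).false
  refine List.Perm.eq_of_pairwise' (r := (· ≤ ·)) (pairwise_sort _ _) ?_ ?_
  · rw [List.pairwise_append]
    refine ⟨pairwise_sort _ _, by simp, ?_⟩
    simpa using fun x hx => (h x hx).le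
  · rw [List.perm_ext_iff_of_nodup (sort_nodup _ _)]
    · simp [or_comm]
    · rw [List.nodup_append]
      refine ⟨sort_nodup _ _, by simp, ?_⟩
      simpa using fun x hx => (h x hx).ne

/-- The proper partial sums of the Hoffman dual of `k`. -/
def coAset (k : List ℕ) : Finset ℕ := Icc 1 (k.sum - 1) \ Aset k

lemma lt_sum_of_mem_coAset {k : List ℕ} {x : ℕ} (hx : x ∈ coAset k) : x < k.sum := by
  have := mem_Icc.1 (Finset.mem_sdiff.1 hx).1
  omega

/-- The list of consecutive differences of `s`, listed increasingly and starting from `0`. -/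
def gaps (s : Finset ℕ) : List ℕ :=
  List.zipWith (fun a b => a - b) (s.sort (· ≤ ·)) (0 :: s.sort (· ≤ ·))

lemma gaps_insert {s : Finset ℕ} {w : ℕ} (h : ∀ x ∈ s, x < w) :
    gaps (insert w s) = gaps s ++ [w - (s.sort (· ≤ ·)).getLastD 0] := by
  rw [gaps, sort_insert_of_forall_lt h, zipWith_sub_concat, gaps]

lemma hdual_eq_gaps (k : List ℕ) : hdual k = gaps (insert k.sum (coAset k)) := rfl

lemma hdual_eq_concat (k : List ℕ) :
    hdual k = gaps (coAset k) ++ [k.sum - ((coAset k).sort (· ≤ ·)).getLastD 0] :=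
  gaps_insert fun _ => lt_sum_of_mem_coAset

lemma hdual_ne_nil (k : List ℕ) : hdual k ≠ [] := by simp [hdual_eq_concat]

lemma Aset_concat (k : List ℕ) (a : ℕ) :
    Aset (k ++ [a]) = (Icc 1 k.length).image (fun i => (k.take i).sum) := by
  ext x
  simp only [Aset, mem_image, mem_Ico, mem_Icc, List.length_append, List.length_singleton,
    Nat.lt_succ_iff]
  refine exists_congr fun i => and_congr_right fun hi => ?_
  rw [List.take_append_of_le_length hi.2]

lemma Aset_concat_of_ne_nil {k : List ℕ} (hk : k ≠ []) (a : ℕ) :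
    Aset (k ++ [a]) = insert k.sum (Aset k) := by
  have := List.length_pos_iff.2 hk
  rw [Aset_concat, Aset, ← Ico_insert_right (by omega), image_insert, List.take_length]

lemma hdual_singleton_one : hdual [1] = [1] := by
  have h : coAset [1] = ∅ := by simp [coAset]
  rw [hdual_eq_concat, h]
  simp [gaps]

lemma exists_hdual_concat_one {k : List ℕ} (hk : k ≠ []) (hpos : ∀ x ∈ k, 0 < x) :
    ∃ l a, hdual k = l ++ [a] ∧ hdual (k ++ [1]) = l ++ [a + 1] := by
  have hsum := List.sum_pos k hpos hk
  have hco : coAset (k ++ [1]) = coAset k := by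
    ext x
    simp only [coAset, Aset_concat_of_ne_nil hk, Finset.mem_sdiff, mem_Icc, mem_insert, List.sum_append,
      List.sum_singleton]
    grind
  refine ⟨_, _, hdual_eq_concat k, ?_⟩
  rw [hdual_eq_concat, hco, List.sum_append, List.sum_singleton, Nat.sub_add_comm]
  rcases List.eq_nil_or_concat ((coAset k).sort (· ≤ ·)) with h | ⟨L, x, h⟩
  · simp [h]
  · have hx : x ∈ coAset k := by
      rw [← mem_sort (· ≤ ·), h]
      simp
    simpa [h] using (lt_sum_of_mem_coAset hx).le

lemma hdual_concat_succ {k : List ℕ} {a : ℕ} (ha : 0 < a) :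
    hdual (k ++ [a + 1]) = hdual (k ++ [a]) ++ [1] := by
  have hnot : (k ++ [a]).sum ∉ Aset (k ++ [a]) := by
    simp only [Aset_concat, mem_image, mem_Icc, not_exists, not_and, List.sum_append,
      List.sum_singleton]
    intro i _
    have := (List.take_sublist i k).sum_le_sum (fun _ _ => Nat.zero_le _)
    omega
  have hco : coAset (k ++ [a + 1]) = insert (k ++ [a]).sum (coAset (k ++ [a])) := by
    have hA : Aset (k ++ [a + 1]) = Aset (k ++ [a]) := by simp only [Aset_concat]
    ext x
    simp only [coAset, hA, Finset.mem_sdiff, mem_Icc, mem_insert, List.sum_append,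
      List.sum_singleton] at hnot ⊢
    grind
  rw [hdual_eq_concat, hco, ← hdual_eq_gaps,
    sort_insert_of_forall_lt fun _ => lt_sum_of_mem_coAset]
  simp [← add_assoc]

end Dual

section Binomial

open Finset

lemma sum_neg_one_pow_mul_sum_mul_choose (f : ℕ → ℝ) (N : ℕ) :
    ∑ n ∈ Icc 1 (N + 1), (-1 : ℝ) ^ (n - 1) * (∑ m ∈ Icc 1 n, f m) * ((N + 1).choose n : ℕ) =
      ∑ n ∈ Icc 1 (N + 1), (-1 : ℝ) ^ (n - 1) * f n * (N.choose (n - 1) : ℕ) := by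
  have key (M : ℕ) :
      ∑ n ∈ Icc 1 M, (-1 : ℝ) ^ (n - 1) * (∑ m ∈ Icc 1 n, f m) * ((N + 1).choose n : ℕ) =
        ∑ n ∈ Icc 1 M, (-1 : ℝ) ^ (n - 1) * f n * (N.choose (n - 1) : ℕ) -
          (-1) ^ M * (∑ m ∈ Icc 1 M, f m) * (N.choose M : ℕ) := by
    induction M with
    | zero => simp
    | succ M ih =>
      simp only [sum_Icc_succ_top (Nat.le_add_left 1 M)] at ih ⊢
      rw [ih, Nat.choose_succ_succ, Nat.add_sub_cancel]
      push_cast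
      ring
  simp [key (N + 1)]

lemma succ_mul_sum_neg_one_pow_mul_choose {g h : ℕ → ℝ} (hgh : ∀ n, 0 < n → n * g n = h n)
    (N : ℕ) :
    ((N + 1 : ℕ) : ℝ) * ∑ n ∈ Icc 1 (N + 1), (-1 : ℝ) ^ (n - 1) * g n * (N.choose (n - 1) : ℕ) =
      ∑ n ∈ Icc 1 (N + 1), (-1 : ℝ) ^ (n - 1) * h n * ((N + 1).choose n : ℕ) := by
  rw [mul_sum]
  refine sum_congr rfl fun n hn => ?_
  obtain ⟨m, rfl⟩ := Nat.exists_eq_add_of_le' (mem_Icc.1 hn).1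
  have hc : ((N + 1 : ℕ) : ℝ) * (N.choose m : ℕ) =
      ((N + 1).choose (m + 1) : ℕ) * ((m + 1 : ℕ) : ℝ) := by
    exact_mod_cast Nat.add_one_mul_choose_eq N m
  rw [← hgh _ m.succ_pos, Nat.add_sub_cancel]
  linear_combination (-1 : ℝ) ^ m * g (m + 1) * hc

lemma sum_Icc_eq_sum_neg_one_pow_mul_choose {f g : ℕ → ℝ}
    (h : ∀ N, f (N + 1) =
      ∑ n ∈ Icc 1 (N + 1), (-1 : ℝ) ^ (n - 1) * g n * (N.choose (n - 1) : ℕ)) (N : ℕ) :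
    ∑ n ∈ Icc 1 N, f n = ∑ n ∈ Icc 1 N, (-1 : ℝ) ^ (n - 1) * g n * (N.choose n : ℕ) := by
  induction N with
  | zero => simp
  | succ N ih =>
    have hN : ∑ n ∈ Icc 1 N, (-1 : ℝ) ^ (n - 1) * g n * (N.choose n : ℕ) =
        ∑ n ∈ Icc 1 (N + 1), (-1 : ℝ) ^ (n - 1) * g n * (N.choose n : ℕ) := by
      simp [sum_Icc_succ_top]
    rw [sum_Icc_succ_top (Nat.le_add_left 1 N), ih, hN, h, ← sum_add_distrib]
    refine sum_congr rfl fun n hn => ?_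
    obtain ⟨m, rfl⟩ := Nat.exists_eq_add_of_le' (mem_Icc.1 hn).1
    rw [Nat.choose_succ_succ, Nat.add_sub_cancel]
    push_cast
    ring

end Binomial

section Duality

open Finset

/-- The form of Hoffman's duality obtained by taking differences in `N`. -/
def DualityAt (k : List ℕ) : Prop :=
  ∀ N, sStar k (N + 1) =
    ∑ n ∈ Icc 1 (N + 1), (-1 : ℝ) ^ (n - 1) * sStar (hdual k) n * (N.choose (n - 1) : ℕ)

lemma dualityAt_singleton_one : DualityAt [1] := by
  intro N
  have hmul (n : ℕ) (hn : 0 < n) : n * sStar [1] n =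
      ∑ m ∈ Icc 1 n, if m = 1 then (1 : ℝ) else 0 := by
    have : 1 ≤ n := hn
    have hn' : (n : ℝ) ≠ 0 := by positivity
    simp [sStar_singleton 1 hn, hn', this]
  have hN : ((N + 1 : ℕ) : ℝ) ≠ 0 := by positivity
  rw [← mul_right_inj' hN, hdual_singleton_one, succ_mul_sum_neg_one_pow_mul_choose hmul,
    sum_neg_one_pow_mul_sum_mul_choose, hmul _ N.succ_pos]
  refine sum_congr rfl fun n _ => ?_
  split_ifs with h <;> simp [h]

lemma DualityAt.concat_one {k : List ℕ} (hk : k ≠ []) (hpos : ∀ x ∈ k, 0 < x)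
    (h : DualityAt k) : DualityAt (k ++ [1]) := by
  intro N
  obtain ⟨l, a, hl, hl'⟩ := exists_hdual_concat_one hk hpos
  have hN : ((N + 1 : ℕ) : ℝ) ≠ 0 := by positivity
  rw [← mul_right_inj' hN, natCast_mul_sStar_concat_one hk N.succ_pos, hl',
    succ_mul_sum_neg_one_pow_mul_choose fun n hn => natCast_mul_sStar_concat_succ l a hn, ← hl]
  exact sum_Icc_eq_sum_neg_one_pow_mul_choose h (N + 1)

lemma DualityAt.concat_succ {k : List ℕ} {a : ℕ} (ha : 0 < a) (h : DualityAt (k ++ [a])) :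
    DualityAt (k ++ [a + 1]) := by
  intro N
  have hN : ((N + 1 : ℕ) : ℝ) ≠ 0 := by positivity
  rw [← mul_right_inj' hN, natCast_mul_sStar_concat_succ k a N.succ_pos, hdual_concat_succ ha,
    succ_mul_sum_neg_one_pow_mul_choose fun n hn =>
      natCast_mul_sStar_concat_one (hdual_ne_nil (k ++ [a])) hn, h N]
  exact (sum_neg_one_pow_mul_sum_mul_choose _ N).symm

lemma dualityAt {k : List ℕ} (hk : k ≠ []) (hpos : ∀ x ∈ k, 0 < x) : DualityAt k := by
  induction k using List.reverseRecOn with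
  | nil => exact absurd rfl hk
  | append_singleton k a ih =>
    have hpos' : ∀ x ∈ k, 0 < x := fun x hx => hpos x (List.mem_append_left _ hx)
    have ha : 1 ≤ a := hpos a (by simp)
    clear hpos hk
    induction a, ha using Nat.le_induction with
    | base =>
      rcases eq_or_ne k [] with rfl | hk
      · exact dualityAt_singleton_one
      · exact (ih hk hpos').concat_one hk hpos'
    | succ a ha iha => exact iha.concat_succ ha

end Duality

/-- Hoffman's duality for `S⋆`:
`S⋆(k,N) = Σ_{n=1}^N (-1)^{n-1} s⋆(k∨,n) · binom(N, n)`. -/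
theorem SStar_hoffman_duality (k : List ℕ) (hk : k ≠ []) (hpos : ∀ x ∈ k, 0 < x)
    (N : ℕ) :
    SStar k N =
      ∑ n ∈ Finset.Icc 1 N,
        (-1 : ℝ) ^ (n - 1) * sStar (hdual k) n * (N.choose n : ℕ) := by
  exact sum_Icc_eq_sum_neg_one_pow_mul_choose (dualityAt hk hpos) N

end Kawashima
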